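/- The subgraph relation ⪯ is a partial order on 𝒢₀: it is reflexive, transitive, and antisymmetric on unlabeled graphs of finite norm. -/

import Mathlib

open scoped ENNReal
open Filter Topology

/-- Edges: 2-element subsets of the vertex set `ℕ`. -/
abbrev Edge : Type := {e : Sym2 ℕ // ¬ e.IsDiag}

/-- A labeled graph: an assignment of a real weight to each edge. -/
abbrev LGraph : Type := Edge → ℝ

/-- The norm of a labeled graph: the sum of the absolute values of its edge weights. -/
noncomputable def gnorm (w : LGraph) : ℝ≥0∞ := ∑' e : Edge, ENNReal.ofReal |w e|

/-- A labeled graph has finite norm if its norm is finite. -/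
def FiniteNorm (w : LGraph) : Prop := gnorm w ≠ ⊤

/-- The distance between two labeled graphs: `d(w,w') = |w - w'|`. -/
noncomputable def ldist (w w' : LGraph) : ℝ≥0∞ := ∑' e : Edge, ENNReal.ofReal |w e - w' e|

/-- A vertex is isolated if every edge containing it has weight `0`. -/
def Isolated (w : LGraph) (v : ℕ) : Prop := ∀ e : Edge, v ∈ e.val → w e = 0

/-- A labeled graph is standard if it has infinitely many isolated vertices. -/
def Standard (w : LGraph) : Prop := {v : ℕ | Isolated w v}.Infinite

/-- The image of an edge under a bijection of the vertex set. -/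
def mapEdge (f : ℕ ≃ ℕ) (e : Edge) : Edge :=
  ⟨e.val.map f, fun h => e.prop ((Sym2.isDiag_map f.injective).mp h)⟩

/-- Two labeled graphs are isomorphic if some bijection of the vertices carries the
weights of one to the other: `w(uv) = w'(f(u)f(v))` for all edges `uv`. -/
def GIso (w w' : LGraph) : Prop := ∃ f : ℕ ≃ ℕ, ∀ e : Edge, w e = w' (mapEdge f e)

/-- The isomorphism class of a labeled graph (as a set of labeled graphs). -/
def cls (w : LGraph) : Set LGraph := {w' | GIso w w'}

/-- The distance between the isomorphism classes of two labeled graphs: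
`d(G,G') = inf { d(u,v) : u ∈ G, v ∈ G' }`. -/
noncomputable def Gdist (w₁ w₂ : LGraph) : ℝ≥0∞ := ⨅ u ∈ cls w₁, ⨅ v ∈ cls w₂, ldist u v

/-- `w ⪯ w'` for labeled graphs: every edge weight of `w` is `0` or agrees with `w'`. -/
def LSub (w w' : LGraph) : Prop := ∀ e : Edge, w e = 0 ∨ w e = w' e

/-- The subgraph relation on unlabeled graphs: some representatives are in the
labeled subgraph relation. -/
def GSub (w w' : LGraph) : Prop := ∃ u ∈ cls w, ∃ v ∈ cls w', LSub u v

@[simp]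
theorem mapEdge_symm_apply (f : ℕ ≃ ℕ) (e : Edge) : mapEdge f.symm (mapEdge f e) = e := by
  apply Subtype.ext
  simp [mapEdge, Sym2.map_map]

@[simp]
theorem mapEdge_apply_symm (f : ℕ ≃ ℕ) (e : Edge) : mapEdge f (mapEdge f.symm e) = e := by
  simpa using mapEdge_symm_apply f.symm e

theorem mapEdge_trans (f g : ℕ ≃ ℕ) (e : Edge) :
    mapEdge (f.trans g) e = mapEdge g (mapEdge f e) := by
  apply Subtype.ext
  simp [mapEdge, Sym2.map_map]

theorem mapEdge_refl (e : Edge) : mapEdge (Equiv.refl ℕ) e = e := by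
  apply Subtype.ext
  simp [mapEdge]

/-- The permutation of the edges induced by a permutation of the vertices. -/
def edgePerm (f : ℕ ≃ ℕ) : Edge ≃ Edge where
  toFun := mapEdge f
  invFun := mapEdge f.symm
  left_inv := mapEdge_symm_apply f
  right_inv := mapEdge_apply_symm f

/-- The subgraph relation on unlabeled graphs in terms of a single vertex bijection. -/
theorem GSub_iff (w w' : LGraph) :
    GSub w w' ↔ ∃ f : ℕ ≃ ℕ, LSub w (w' ∘ mapEdge f) := by
  constructor
  · rintro ⟨u, ⟨f, hf⟩, v, ⟨g, hg⟩, huv⟩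
    refine ⟨f.trans g.symm, fun e => ?_⟩
    simpa [hf, hg, mapEdge_trans] using huv (mapEdge f e)
  · rintro ⟨f, hf⟩
    exact ⟨w, ⟨Equiv.refl ℕ, fun e => by rw [mapEdge_refl]⟩, w' ∘ mapEdge f,
      ⟨f.symm, fun e => by simp⟩, hf⟩

theorem LSub.trans {u v w : LGraph} (huv : LSub u v) (hvw : LSub v w) : LSub u w := by
  intro e
  rcases huv e with h | h
  · exact .inl h
  · exact h ▸ hvw e

theorem LSub.comp_mapEdge {u v : LGraph} (h : LSub u v) (f : ℕ ≃ ℕ) :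
    LSub (u ∘ mapEdge f) (v ∘ mapEdge f) :=
  fun e => h (mapEdge f e)

theorem gnorm_comp_mapEdge (w : LGraph) (f : ℕ ≃ ℕ) : gnorm (w ∘ mapEdge f) = gnorm w :=
  (edgePerm f).tsum_eq fun e => ENNReal.ofReal |w e|

theorem LSub.ofReal_abs_le {u v : LGraph} (h : LSub u v) (e : Edge) :
    ENNReal.ofReal |u e| ≤ ENNReal.ofReal |v e| := by
  rcases h e with h | h <;> simp [h]

theorem LSub.gnorm_le {u v : LGraph} (h : LSub u v) : gnorm u ≤ gnorm v :=
  ENNReal.tsum_le_tsum h.ofReal_abs_le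

/-- A subgraph of finite norm whose norm is at least that of the whole graph is the whole graph. -/
theorem LSub.eq_of_gnorm_le {u v : LGraph} (h : LSub u v) (hu : FiniteNorm u)
    (hvu : gnorm v ≤ gnorm u) : u = v := by
  funext e
  by_contra hne
  have hu0 : u e = 0 := (h e).resolve_right hne
  have hv0 : v e ≠ 0 := fun hv => hne (hu0.trans hv.symm)
  have hlt : ENNReal.ofReal |u e| < ENNReal.ofReal |v e| := by simpa [hu0] using hv0
  exact (ENNReal.tsum_lt_tsum hu h.ofReal_abs_le hlt).not_ge hvu

/-- The subgraph relation is a partial order on `𝒢₀`: reflexive, transitive, and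
antisymmetric (up to isomorphism of representatives). -/
theorem GSub_partialOrder :
    (∀ w : LGraph, Standard w → FiniteNorm w → GSub w w) ∧
    (∀ w₁ w₂ w₃ : LGraph, Standard w₁ → FiniteNorm w₁ → Standard w₂ → FiniteNorm w₂ →
      Standard w₃ → FiniteNorm w₃ → GSub w₁ w₂ → GSub w₂ w₃ → GSub w₁ w₃) ∧
    (∀ w w' : LGraph, Standard w → FiniteNorm w → Standard w' → FiniteNorm w' →
      GSub w w' → GSub w' w → GIso w w') := by
  simp only [GSub_iff]
  refine ⟨fun w _ _ => ⟨Equiv.refl ℕ, fun e => .inr ?_⟩, ?_, ?_⟩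
  · simp [mapEdge_refl]
  · rintro w₁ w₂ w₃ - - - - - - ⟨f, hf⟩ ⟨g, hg⟩
    refine ⟨f.trans g, fun e => ?_⟩
    simpa [mapEdge_trans] using hf.trans (hg.comp_mapEdge f) e
  · rintro w w' - hw - - ⟨f, hf⟩ ⟨g, hg⟩
    refine ⟨f, congrFun (hf.eq_of_gnorm_le hw ?_)⟩
    rw [gnorm_comp_mapEdge, ← gnorm_comp_mapEdge w g]
    exact hg.gnorm_le
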